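/- (N-fold binary Darboux transformation in Grammian form.) Let a_1, a_2, a_3 be nonzero complex numbers and let τ : ℤ³ × ℝ → ℂ be nowhere vanishing, smooth in x, and satisfy the semi-discrete KP equation. Let θ_1,…,θ_N and φ be smooth solutions of the forward linear system with potential τ, and let ρ_1,…,ρ_N and ψ be smooth solutions of the backward linear system with potential τ. Suppose smooth functions ω_{rs} (1 ≤ r,s ≤ N), ω_{φ,s} (1 ≤ s ≤ N) and ω_{r,ψ} (1 ≤ r ≤ N) satisfy, for every i = 1,2,3: a_i((ω_{rs})_i − ω_{rs}) = θ_r (ρ_s)_i and (ω_{rs})_x = θ_r ρ_s; a_i((ω_{φ,s})_i − ω_{φ,s}) = φ(ρ_s)_i and (ω_{φ,s})_x = φρ_s; a_i((ω_{r,ψ})_i − ω_{r,ψ}) = θ_r ψ_i and (ω_{r,ψ})_x = θ_r ψ. Let Ω be the N×N matrix with entries ω_{rs}, and assume det Ω is nowhere zero. Then τ[N] := (det Ω)·τ and φ[N] := D_φ/det Ω satisfy the forward linear system with potential τ[N], where D_φ is the determinant of the (N+1)×(N+1) matrix with (r,s) entry ω_{rs} for r,s ≤ N, (r,N+1) entry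 θ_r, (N+1,s) entry ω_{φ,s}, and (N+1,N+1) entry φ; and ψ[N] := D_ψ/det Ω satisfies the backward linear system with potential τ[N], where D_ψ is the determinant of the (N+1)×(N+1) matrix with (r,s) entry ω_{sr} for r,s ≤ N, (r,N+1) entry ρ_r, (N+1,s) entry ω_{s,ψ}, and (N+1,N+1) entry ψ. -/

import Mathlib

noncomputable section

/-- Forward shift in the `i`-th discrete direction of `ℤ³`. -/
def fwd (i : Fin 3) (n : Fin 3 → ℤ) : Fin 3 → ℤ := Function.update n i (n i + 1)

/-- Backward shift in the `i`-th discrete direction of `ℤ³`. -/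
def bwd (i : Fin 3) (n : Fin 3 → ℤ) : Fin 3 → ℤ := Function.update n i (n i - 1)

/-- The semi-discrete KP equation:
`(a_i − a_j)(τ_{ij}τ − τ_i τ_j) + τ_{i,x} τ_j − τ_i τ_{j,x} = 0` for all `1 ≤ i < j ≤ 3`. -/
def SemiKP (a : Fin 3 → ℂ) (τ : (Fin 3 → ℤ) → ℝ → ℂ) : Prop :=
  ∀ i j : Fin 3, i < j → ∀ n x,
    (a i - a j) * (τ (fwd i (fwd j n)) x * τ n x - τ (fwd i n) x * τ (fwd j n) x)
      + deriv (τ (fwd i n)) x * τ (fwd j n) x - τ (fwd i n) x * deriv (τ (fwd j n)) x = 0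

/-- The forward linear system for `φ` with potential `τ`:
`a_i φ_i − a_j φ_j = (a_i − a_j)(τ_{ij}τ/(τ_i τ_j))φ` for `1 ≤ i < j ≤ 3`, together with
`φ_x = a_i φ_i + ((τ_x/τ)_i − τ_x/τ − a_i)φ` for `i = 1,2,3`. -/
def FwdLin (a : Fin 3 → ℂ) (τ φ : (Fin 3 → ℤ) → ℝ → ℂ) : Prop :=
  (∀ i j : Fin 3, i < j → ∀ n x,
    a i * φ (fwd i n) x - a j * φ (fwd j n) x
      = (a i - a j) * (τ (fwd i (fwd j n)) x * τ n x / (τ (fwd i n) x * τ (fwd j n) x))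
          * φ n x)
  ∧ ∀ i : Fin 3, ∀ n x,
      deriv (φ n) x = a i * φ (fwd i n) x
        + (deriv (τ (fwd i n)) x / τ (fwd i n) x - deriv (τ n) x / τ n x - a i) * φ n x

/-- The backward linear system for `ψ` with potential `τ`:
`a_i ψ_ī − a_j ψ_j̄ = (a_i − a_j)(τ_{īj̄}τ/(τ_ī τ_j̄))ψ` for `1 ≤ i < j ≤ 3`, together with
`ψ_x = −a_i ψ_ī + ((τ_x/τ)_ī − τ_x/τ + a_i)ψ` for `i = 1,2,3`. -/
def BwdLin (a : Fin 3 → ℂ) (τ ψ : (Fin 3 → ℤ) → ℝ → ℂ) : Prop :=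
  (∀ i j : Fin 3, i < j → ∀ n x,
    a i * ψ (bwd i n) x - a j * ψ (bwd j n) x
      = (a i - a j) * (τ (bwd i (bwd j n)) x * τ n x / (τ (bwd i n) x * τ (bwd j n) x))
          * ψ n x)
  ∧ ∀ i : Fin 3, ∀ n x,
      deriv (ψ n) x = -(a i) * ψ (bwd i n) x
        + (deriv (τ (bwd i n)) x / τ (bwd i n) x - deriv (τ n) x / τ n x + a i) * ψ n x

open Matrix

section RankOne

variable {ι : Type*} [Fintype ι] [DecidableEq ι]

/-- Matrix determinant lemma for a rank-one update scaled by `α`. -/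
theorem mul_det_of_smul_sub_eq_vecMulVec {A B : Matrix ι ι ℂ} {u v : ι → ℂ} {α : ℂ}
    (hα : α ≠ 0) (hA : A.det ≠ 0) (h : α • (B - A) = vecMulVec u v) :
    α * B.det = A.det * (α + v ⬝ᵥ (A⁻¹ *ᵥ u)) := by
  have hB : B = A + replicateCol Unit (α⁻¹ • u) * replicateRow Unit v := by
    rw [← vecMulVec_eq, smul_vecMulVec, ← h, smul_smul, inv_mul_cancel₀ hα, one_smul,
      add_sub_cancel]
  rw [hB, det_add_replicateCol_mul_replicateRow hA.isUnit, det_unique (n := Unit), Matrix.add_apply,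
    Matrix.mul_assoc, ← replicateCol_mulVec, replicateRow_mul_replicateCol_apply, mulVec_smul,
    dotProduct_smul, one_apply_eq, smul_eq_mul]
  field_simp

/-- The same update, expressed through the inverse of the updated matrix. -/
theorem mul_det_of_smul_sub_eq_vecMulVec' {A B : Matrix ι ι ℂ} {u v : ι → ℂ} {α : ℂ}
    (hα : α ≠ 0) (hB : B.det ≠ 0) (h : α • (B - A) = vecMulVec u v) :
    α * A.det = B.det * (α - v ⬝ᵥ (B⁻¹ *ᵥ u)) := by
  have h' : (-α) • (A - B) = vecMulVec u v := by
    rw [← h, neg_smul, ← smul_neg, neg_sub]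
  linear_combination -mul_det_of_smul_sub_eq_vecMulVec (neg_ne_zero.2 hα) hB h'

/-- Resolvent identity in bilinear form. -/
theorem dotProduct_inv_mulVec_sub {A B : Matrix ι ι ℂ} (hA : A.det ≠ 0) (hB : B.det ≠ 0)
    (w t : ι → ℂ) :
    w ⬝ᵥ (A⁻¹ *ᵥ t) - w ⬝ᵥ (B⁻¹ *ᵥ t) = w ⬝ᵥ (A⁻¹ *ᵥ ((B - A) *ᵥ (B⁻¹ *ᵥ t))) := by
  rw [← dotProduct_sub, ← sub_mulVec, mulVec_mulVec, mulVec_mulVec, Matrix.mul_sub,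
    nonsing_inv_mul _ hA.isUnit, Matrix.sub_mul, Matrix.mul_assoc, mul_nonsing_inv _ hB.isUnit,
    Matrix.mul_one, Matrix.one_mul]

/-- The Schur complement `c - u A⁻¹ v` of a bordered matrix. -/
def borderedQuotient (A : Matrix ι ι ℂ) (u v : ι → ℂ) (c : ℂ) : ℂ := c - u ⬝ᵥ (A⁻¹ *ᵥ v)

/-- Change of a bordered quotient under a rank-one update of the matrix and of its lower border. -/
theorem borderedQuotient_update {A B : Matrix ι ι ℂ} {u u' v w : ι → ℂ} {c α : ℂ}
    (hA : A.det ≠ 0) (hB : B.det ≠ 0)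
    (h : α • (B - A) = vecMulVec v w) (hu : α • (u' - u) = c • w) (t : ι → ℂ) (d : ℂ) :
    α * borderedQuotient A u t d =
      α * borderedQuotient B u' t d + (w ⬝ᵥ (B⁻¹ *ᵥ t)) * borderedQuotient A u v c := by
  have h1 := dotProduct_inv_mulVec_sub hA hB u t
  have h2 : α * (u ⬝ᵥ (A⁻¹ *ᵥ ((B - A) *ᵥ (B⁻¹ *ᵥ t)))) =
      (w ⬝ᵥ (B⁻¹ *ᵥ t)) * (u ⬝ᵥ (A⁻¹ *ᵥ v)) := by
    rw [← smul_eq_mul α, ← dotProduct_smul, ← mulVec_smul, ← smul_mulVec, h, vecMulVec_mulVec]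
    simp [mulVec_smul]
  have h3 : α * (u' ⬝ᵥ (B⁻¹ *ᵥ t) - u ⬝ᵥ (B⁻¹ *ᵥ t)) = c * (w ⬝ᵥ (B⁻¹ *ᵥ t)) := by
    rw [← sub_dotProduct, ← smul_eq_mul, ← smul_dotProduct, hu, smul_dotProduct, smul_eq_mul]
  unfold borderedQuotient
  linear_combination (-α) * h1 - h2 + h3

/-- Bilinear identity for Gram determinants over an elementary lattice square. -/
theorem gram_square_identity {A B C E : Matrix ι ι ℂ} {t ti tj r ri rj : ι → ℂ} {α β k : ℂ}
    (hα : α ≠ 0) (hB : B.det ≠ 0) (hC : C.det ≠ 0)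
    (hAB : α • (B - A) = vecMulVec t ri) (hAC : β • (C - A) = vecMulVec t rj)
    (hCE : α • (E - C) = vecMulVec tj r)
    (ht : k • t = α • ti - β • tj) (hr : k • r = α • rj - β • ri) :
    k * (E.det * A.det - B.det * C.det) +
      (ri ⬝ᵥ (B⁻¹ *ᵥ ti) - rj ⬝ᵥ (C⁻¹ *ᵥ tj)) * (B.det * C.det) = 0 := by
  have hE := mul_det_of_smul_sub_eq_vecMulVec hα hC hCE
  have hA := mul_det_of_smul_sub_eq_vecMulVec' hα hB hAB
  have hX : k * (ri ⬝ᵥ (B⁻¹ *ᵥ t)) =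
      α * (ri ⬝ᵥ (B⁻¹ *ᵥ ti)) - β * (ri ⬝ᵥ (B⁻¹ *ᵥ tj)) := by
    have := congrArg (fun z => ri ⬝ᵥ (B⁻¹ *ᵥ z)) ht
    simpa [mulVec_smul, mulVec_sub, dotProduct_sub] using this
  have hY : k * (r ⬝ᵥ (C⁻¹ *ᵥ tj)) =
      α * (rj ⬝ᵥ (C⁻¹ *ᵥ tj)) - β * (ri ⬝ᵥ (C⁻¹ *ᵥ tj)) := by
    have := congrArg (fun z => z ⬝ᵥ (C⁻¹ *ᵥ tj)) hr
    simpa [sub_dotProduct] using this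
  have hR := dotProduct_inv_mulVec_sub hB hC ri tj
  have hCB : (α * β) • (C - B) = vecMulVec t (α • rj - β • ri) := by
    have : (α * β) • (C - B) = α • (β • (C - A)) - β • (α • (B - A)) := by module
    rw [this, hAB, hAC, vecMulVec_sub, vecMulVec_smul, vecMulVec_smul]
  have hS : α * β * (ri ⬝ᵥ (B⁻¹ *ᵥ ((C - B) *ᵥ (C⁻¹ *ᵥ tj)))) =
      (ri ⬝ᵥ (B⁻¹ *ᵥ t)) * (α * (rj ⬝ᵥ (C⁻¹ *ᵥ tj)) - β * (ri ⬝ᵥ (C⁻¹ *ᵥ tj))) := by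
    rw [← smul_eq_mul (α * β), ← dotProduct_smul, ← mulVec_smul, ← smul_mulVec, hCB,
      vecMulVec_mulVec]
    simp [mulVec_smul, sub_dotProduct]
  refine (mul_eq_zero.1 ?_).resolve_left (pow_ne_zero 2 hα)
  linear_combination k * α * A.det * hE + k * C.det * (α + r ⬝ᵥ (C⁻¹ *ᵥ tj)) * hA
    + B.det * C.det * (-α * hX + (α - ri ⬝ᵥ (B⁻¹ *ᵥ t)) * hY + α * β * hR + hS)

/-- Jacobi's formula when the derivative of the matrix has rank one. -/
theorem hasDerivAt_det_of_rankOne {M : ℝ → Matrix ι ι ℂ} {u v : ι → ℂ} {x : ℝ}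
    (hM : ∀ r s, HasDerivAt (fun y => M y r s) (u r * v s) x) (h0 : (M x).det ≠ 0) :
    HasDerivAt (fun y => (M y).det) ((M x).det * (v ⬝ᵥ ((M x)⁻¹ *ᵥ u))) x := by
  have hdet : DifferentiableAt ℝ (fun P : ι → ι → ℂ => (Matrix.of P).det) (M x) := by
    simp only [Matrix.det_apply, Matrix.of_apply]
    fun_prop
  have hM' : HasDerivAt (fun y r s => M y r s) (fun r s => u r * v s) x :=
    hasDerivAt_pi.2 fun r => hasDerivAt_pi.2 fun s => hM r s
  have hline : HasDerivAt (fun (y : ℝ) r s => M x r s + (y : ℂ) * (u r * v s))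
      (fun r s => u r * v s) 0 :=
    hasDerivAt_pi.2 fun r => hasDerivAt_pi.2 fun s => by
      simpa using ((Complex.ofRealCLM.hasDerivAt (x := (0 : ℝ))).mul_const (u r * v s)).const_add
        (M x r s)
  have hdet0 : DifferentiableAt ℝ (fun P : ι → ι → ℂ => (Matrix.of P).det)
      ((fun (y : ℝ) r s => M x r s + (y : ℂ) * (u r * v s)) 0) := by simpa using hdet
  have h1 := hdet.hasFDerivAt.comp_hasDerivAt x hM'
  have h2 := hdet0.hasFDerivAt.comp_hasDerivAt 0 hline
  have h3 : HasDerivAt (fun y : ℝ => (M x).det * (1 + (y : ℂ) * (v ⬝ᵥ ((M x)⁻¹ *ᵥ u))))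
      ((M x).det * (v ⬝ᵥ ((M x)⁻¹ *ᵥ u))) 0 := by
    simpa using (((Complex.ofRealCLM.hasDerivAt (x := (0 : ℝ))).mul_const
      (v ⬝ᵥ ((M x)⁻¹ *ᵥ u))).const_add 1).const_mul (M x).det
  have h4 : ((fun P : ι → ι → ℂ => (Matrix.of P).det) ∘
      fun (y : ℝ) r s => M x r s + (y : ℂ) * (u r * v s)) =
      fun y : ℝ => (M x).det * (1 + (y : ℂ) * (v ⬝ᵥ ((M x)⁻¹ *ᵥ u))) := by
    funext y
    have := mul_det_of_smul_sub_eq_vecMulVec (A := M x)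
      (B := Matrix.of fun r s => M x r s + (y : ℂ) * (u r * v s))
      (u := (y : ℂ) • u) (v := v) one_ne_zero h0 (by
        ext r s
        simp [vecMulVec_apply, mul_assoc])
    simpa [mulVec_smul] using this
  rw [h4] at h2
  refine h1.congr_deriv (Eq.trans ?_ (h2.unique h3))
  simp

/-- Derivative of a bordered quotient along a rank-one flow. -/
theorem hasDerivAt_borderedQuotient {M : ℝ → Matrix ι ι ℂ} {u v : ℝ → ι → ℂ} {c : ℝ → ℂ}
    {v' w : ι → ℂ} {c' : ℂ} {x : ℝ}
    (hM : ∀ r s, HasDerivAt (fun y => M y r s) (v x r * w s) x)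
    (h0 : ∀ y, (M y).det ≠ 0)
    (hu : ∀ s, HasDerivAt (fun y => u y s) (c x * w s) x)
    (hv : ∀ r, HasDerivAt (fun y => v y r) (v' r) x) (hc : HasDerivAt c c' x) :
    HasDerivAt (fun y => borderedQuotient (M y) (u y) (v y) (c y))
      (borderedQuotient (M x) (u x) v' c' -
        (w ⬝ᵥ ((M x)⁻¹ *ᵥ v x)) * borderedQuotient (M x) (u x) (v x) (c x)) x := by
  have hadj : ∀ r s, DifferentiableAt ℝ (fun y => (M y).adjugate r s) x := by
    intro r s
    have hd : ∀ p q, DifferentiableAt ℝ (fun y => M y p q) x :=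
      fun p q => (hM p q).differentiableAt
    simp only [adjugate_apply, Matrix.det_apply, updateRow_apply]
    refine DifferentiableAt.fun_sum fun σ _ => DifferentiableAt.const_smul ?_ _
    refine DifferentiableAt.fun_finsetProd fun i _ => ?_
    split_ifs <;> fun_prop
  have hdet := (hasDerivAt_det_of_rankOne hM (h0 x)).differentiableAt
  have hz : ∀ r, DifferentiableAt ℝ (fun y => ((M y)⁻¹ *ᵥ v y) r) x := by
    intro r
    have hv' : ∀ s, DifferentiableAt ℝ (fun y => v y s) x := fun s => (hv s).differentiableAt
    simp only [mulVec, dotProduct, inv_def, Matrix.smul_apply, Ring.inverse_eq_inv', smul_eq_mul]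
    exact DifferentiableAt.fun_sum fun s _ => ((hdet.inv (h0 x)).mul (hadj r s)).mul (hv' s)
  choose z' hz' using fun r => (⟨_, (hz r).hasDerivAt⟩ :
    ∃ d, HasDerivAt (fun y => ((M y)⁻¹ *ᵥ v y) r) d x)
  set z := (M x)⁻¹ *ᵥ v x with hzdef
  have hMz : ∀ y, M y *ᵥ ((M y)⁻¹ *ᵥ v y) = v y := fun y => by
    rw [mulVec_mulVec, mul_nonsing_inv _ (h0 y).isUnit, one_mulVec]
  have hlin : (w ⬝ᵥ z) • v x + M x *ᵥ z' = v' := by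
    funext r
    have h1 : HasDerivAt (fun y => ∑ s, M y r s * ((M y)⁻¹ *ᵥ v y) s)
        (∑ s, (v x r * w s * z s + M x r s * z' s)) x :=
      HasDerivAt.fun_sum fun s _ => (hM r s).mul (hz' s)
    have h2 : (fun y => ∑ s, M y r s * ((M y)⁻¹ *ᵥ v y) s) = fun y => v y r :=
      funext fun y => congrFun (hMz y) r
    rw [h2] at h1
    rw [← h1.unique (hv r)]
    simp only [Pi.add_apply, Pi.smul_apply, smul_eq_mul, mulVec, dotProduct,
      Finset.sum_add_distrib, Finset.sum_mul]
    congr 1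
    exact Finset.sum_congr rfl fun s _ => by ring
  have hz'eq : z' = (M x)⁻¹ *ᵥ v' - (w ⬝ᵥ z) • z := by
    rw [← hlin, mulVec_add, mulVec_smul, mulVec_mulVec, nonsing_inv_mul _ (h0 x).isUnit,
      one_mulVec, ← hzdef, add_sub_cancel_left]
  have h3 : HasDerivAt (fun y => c y - ∑ s, u y s * ((M y)⁻¹ *ᵥ v y) s)
      (c' - ∑ s, (c x * w s * z s + u x s * z' s)) x :=
    hc.sub (HasDerivAt.fun_sum fun s _ => (hu s).mul (hz' s))
  refine h3.congr_deriv ?_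
  have h4 : ∑ s, (c x * w s * z s + u x s * z' s) = c x * (w ⬝ᵥ z) + u x ⬝ᵥ z' := by
    simp only [dotProduct, Finset.sum_add_distrib, Finset.mul_sum, mul_assoc]
  rw [h4, hz'eq, dotProduct_sub, dotProduct_smul, smul_eq_mul]
  unfold borderedQuotient
  rw [← hzdef]
  ring

/-- Determinant of a matrix bordered by a last row and a last column. -/
theorem det_bordered_div_det {N : ℕ} {M : Fin N → Fin N → ℂ} (h0 : (Matrix.of M).det ≠ 0)
    (u v : Fin N → ℂ) (c : ℂ) :
    Matrix.det (Matrix.of fun r s : Fin (N + 1) =>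
      if hr : (r : ℕ) < N then
        if hs : (s : ℕ) < N then M ⟨r, hr⟩ ⟨s, hs⟩ else v ⟨r, hr⟩
      else
        if hs : (s : ℕ) < N then u ⟨s, hs⟩ else c) / (Matrix.of M).det
      = borderedQuotient (Matrix.of M) u v c := by
  have := (Matrix.of M).invertibleOfIsUnitDet h0.isUnit
  have h1 : (Matrix.of fun r s : Fin (N + 1) =>
      if hr : (r : ℕ) < N then
        if hs : (s : ℕ) < N then M ⟨r, hr⟩ ⟨s, hs⟩ else v ⟨r, hr⟩
      else
        if hs : (s : ℕ) < N then u ⟨s, hs⟩ else c) =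
      (fromBlocks (Matrix.of M) (replicateCol (Fin 1) v) (replicateRow (Fin 1) u)
        (Matrix.of fun _ _ => c)).submatrix finSumFinEquiv.symm finSumFinEquiv.symm := by
    ext r s
    refine Fin.lastCases ?_ (fun r => ?_) r <;> refine Fin.lastCases ?_ (fun s => ?_) s <;> simp
  rw [h1, det_submatrix_equiv_self, det_fromBlocks₁₁, mul_div_cancel_left₀ _ h0, det_unique,
    invOf_eq_nonsing_inv, Matrix.mul_assoc, ← replicateCol_mulVec, Matrix.sub_apply,
    replicateRow_mul_replicateCol_apply]
  rfl

end RankOne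

section Lattice

theorem fwd_bwd (i : Fin 3) (n : Fin 3 → ℤ) : fwd i (bwd i n) = n := by
  simp [fwd, bwd]

theorem bwd_fwd (i : Fin 3) (n : Fin 3 → ℤ) : bwd i (fwd i n) = n := by
  simp [fwd, bwd]

theorem fwd_comm (i j : Fin 3) (n : Fin 3 → ℤ) : fwd i (fwd j n) = fwd j (fwd i n) := by
  rcases eq_or_ne i j with rfl | h
  · rfl
  · simp [fwd, Function.update_of_ne h, Function.update_of_ne h.symm, Function.update_comm h]

theorem bwd_comm (i j : Fin 3) (n : Fin 3 → ℤ) : bwd i (bwd j n) = bwd j (bwd i n) := by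
  rcases eq_or_ne i j with rfl | h
  · rfl
  · simp [bwd, Function.update_of_ne h, Function.update_of_ne h.symm, Function.update_comm h]

variable {a : Fin 3 → ℂ} {τ : (Fin 3 → ℤ) → ℝ → ℂ}

theorem SemiKP.ratio_eq (h : SemiKP a τ) (hτ0 : ∀ n x, τ n x ≠ 0) {i j : Fin 3} (hij : i < j)
    (n : Fin 3 → ℤ) (x : ℝ) :
    (a i - a j) * (τ (fwd i (fwd j n)) x * τ n x / (τ (fwd i n) x * τ (fwd j n) x)) =
      a i - a j - deriv (τ (fwd i n)) x / τ (fwd i n) x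
        + deriv (τ (fwd j n)) x / τ (fwd j n) x := by
  have := h i j hij n x
  have hi := hτ0 (fwd i n) x
  have hj := hτ0 (fwd j n) x
  field_simp
  linear_combination this

/-- Under semi-discrete KP, the differential part of the forward system implies the rest. -/
theorem FwdLin.of_deriv {φ : (Fin 3 → ℤ) → ℝ → ℂ} (h : SemiKP a τ) (hτ0 : ∀ n x, τ n x ≠ 0)
    (hφ : ∀ i : Fin 3, ∀ n x, deriv (φ n) x = a i * φ (fwd i n) x
      + (deriv (τ (fwd i n)) x / τ (fwd i n) x - deriv (τ n) x / τ n x - a i) * φ n x) :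
    FwdLin a τ φ := by
  refine ⟨fun i j hij n x => ?_, hφ⟩
  rw [h.ratio_eq hτ0 hij]
  linear_combination hφ j n x - hφ i n x

/-- Under semi-discrete KP, the differential part of the backward system implies the rest. -/
theorem BwdLin.of_deriv {ψ : (Fin 3 → ℤ) → ℝ → ℂ} (h : SemiKP a τ) (hτ0 : ∀ n x, τ n x ≠ 0)
    (hψ : ∀ i : Fin 3, ∀ n x, deriv (ψ n) x = -(a i) * ψ (bwd i n) x
      + (deriv (τ (bwd i n)) x / τ (bwd i n) x - deriv (τ n) x / τ n x + a i) * ψ n x) :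
    BwdLin a τ ψ := by
  refine ⟨fun i j hij n x => ?_, hψ⟩
  have hr := h.ratio_eq hτ0 hij (bwd i (bwd j n)) x
  rw [fwd_comm, fwd_bwd, fwd_bwd, bwd_comm i j, fwd_bwd, mul_comm (τ n x),
    mul_comm (τ (bwd j n) x)] at hr
  rw [bwd_comm i j, hr]
  linear_combination hψ i n x - hψ j n x

end Lattice

section Gram

variable {ι : Type*} [Fintype ι] [DecidableEq ι] {a : Fin 3 → ℂ} {τ : (Fin 3 → ℤ) → ℝ → ℂ}
  {θ ρ : (Fin 3 → ℤ) → ℝ → ι → ℂ} {Ω : (Fin 3 → ℤ) → ℝ → Matrix ι ι ℂ}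

/-- Logarithmic derivative of the Darboux-transformed potential. -/
theorem deriv_det_mul_div (hτ0 : ∀ n x, τ n x ≠ 0) (hτd : ∀ n, Differentiable ℝ (τ n))
    (hΩx : ∀ n x r s, HasDerivAt (fun y => Ω n y r s) (θ n x r * ρ n x s) x)
    (hΩ0 : ∀ n x, (Ω n x).det ≠ 0) (n : Fin 3 → ℤ) (x : ℝ) :
    deriv (fun y => (Ω n y).det * τ n y) x / ((Ω n x).det * τ n x) =
      ρ n x ⬝ᵥ ((Ω n x)⁻¹ *ᵥ θ n x) + deriv (τ n) x / τ n x := by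
  rw [((hasDerivAt_det_of_rankOne (hΩx n x) (hΩ0 n x)).fun_mul (hτd n x).hasDerivAt).deriv]
  have h1 := hΩ0 n x
  have h2 := hτ0 n x
  field_simp

/-- The Gram determinant multiplies semi-discrete KP solutions to solutions. -/
theorem SemiKP.det_mul (ha : ∀ i, a i ≠ 0) (hKP : SemiKP a τ) (hτ0 : ∀ n x, τ n x ≠ 0)
    (hτd : ∀ n, Differentiable ℝ (τ n))
    (hθ : ∀ r, FwdLin a τ fun n x => θ n x r) (hρ : ∀ s, BwdLin a τ fun n x => ρ n x s)
    (hΩd : ∀ i n x, a i • (Ω (fwd i n) x - Ω n x) = vecMulVec (θ n x) (ρ (fwd i n) x))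
    (hΩx : ∀ n x r s, HasDerivAt (fun y => Ω n y r s) (θ n x r * ρ n x s) x)
    (hΩ0 : ∀ n x, (Ω n x).det ≠ 0) :
    SemiKP a fun n x => (Ω n x).det * τ n x := by
  intro i j hij n x
  set T := τ (fwd i (fwd j n)) x * τ n x / (τ (fwd i n) x * τ (fwd j n) x) with hT
  have hE := hΩd i (fwd j n) x
  have hsq := gram_square_identity (k := (a i - a j) * T) (r := ρ (fwd i (fwd j n)) x)
    (ti := θ (fwd i n) x) (ha i) (hΩ0 (fwd i n) x) (hΩ0 (fwd j n) x) (hΩd i n x)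
    (hΩd j n x) hE
    (by
      funext r
      simpa using ((hθ r).1 i j hij n x).symm)
    (by
      funext s
      have h := (hρ s).1 i j hij (fwd i (fwd j n)) x
      have hj : bwd j (fwd i (fwd j n)) = fwd i n := by rw [fwd_comm, bwd_fwd]
      simp only [hj, bwd_fwd] at h
      simp only [Pi.smul_apply, Pi.sub_apply, smul_eq_mul]
      rw [h, hT]
      ring)
  have hr := hKP.ratio_eq hτ0 hij n x
  rw [← hT] at hr
  have hTe : τ (fwd i (fwd j n)) x * τ n x = T * (τ (fwd i n) x * τ (fwd j n) x) :=
    (div_mul_cancel₀ _ (mul_ne_zero (hτ0 _ _) (hτ0 _ _))).symm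
  have hd := fun m => (div_eq_iff (mul_ne_zero (hΩ0 m x) (hτ0 m x))).1
    (deriv_det_mul_div hτ0 hτd hΩx hΩ0 m x)
  rw [hd, hd]
  linear_combination (τ (fwd i n) x * τ (fwd j n) x) * hsq
    + (a i - a j) * (Ω (fwd i (fwd j n)) x).det * (Ω n x).det * hTe
    + (Ω (fwd i n) x).det * (Ω (fwd j n) x).det * (τ (fwd i n) x * τ (fwd j n) x) * hr

/-- Binary Darboux transformation of a solution of the forward system. -/
theorem FwdLin.borderedQuotient {φ : (Fin 3 → ℤ) → ℝ → ℂ} {ωφ : (Fin 3 → ℤ) → ℝ → ι → ℂ}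
    (ha : ∀ i, a i ≠ 0) (hKP : SemiKP a τ) (hτ0 : ∀ n x, τ n x ≠ 0)
    (hτd : ∀ n, Differentiable ℝ (τ n))
    (hθ : ∀ r, FwdLin a τ fun n x => θ n x r) (hρ : ∀ s, BwdLin a τ fun n x => ρ n x s)
    (hφ : FwdLin a τ φ)
    (hθd : ∀ n x r, DifferentiableAt ℝ (fun y => θ n y r) x) (hφd : ∀ n, Differentiable ℝ (φ n))
    (hΩd : ∀ i n x, a i • (Ω (fwd i n) x - Ω n x) = vecMulVec (θ n x) (ρ (fwd i n) x))
    (hΩx : ∀ n x r s, HasDerivAt (fun y => Ω n y r s) (θ n x r * ρ n x s) x)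
    (hωφd : ∀ i n x, a i • (ωφ (fwd i n) x - ωφ n x) = φ n x • ρ (fwd i n) x)
    (hωφx : ∀ n x s, HasDerivAt (fun y => ωφ n y s) (φ n x * ρ n x s) x)
    (hΩ0 : ∀ n x, (Ω n x).det ≠ 0) :
    FwdLin a (fun n x => (Ω n x).det * τ n x)
      fun n x => _root_.borderedQuotient (Ω n x) (ωφ n x) (θ n x) (φ n x) := by
  refine FwdLin.of_deriv (hKP.det_mul ha hτ0 hτd hθ hρ hΩd hΩx hΩ0)
    (fun n x => mul_ne_zero (hΩ0 n x) (hτ0 n x)) fun i n x => ?_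
  rw [(hasDerivAt_borderedQuotient (hΩx n x) (hΩ0 n) (hωφx n x)
    (fun r => (hθd n x r).hasDerivAt) (hφd n x).hasDerivAt).deriv,
    deriv_det_mul_div hτ0 hτd hΩx hΩ0, deriv_det_mul_div hτ0 hτd hΩx hΩ0]
  have hup := borderedQuotient_update (hΩ0 n x) (hΩ0 (fwd i n) x) (hΩd i n x) (hωφd i n x)
    (θ (fwd i n) x) (φ (fwd i n) x)
  have hv : (fun r => deriv (fun y => θ n y r) x) = a i • θ (fwd i n) x +
      (deriv (τ (fwd i n)) x / τ (fwd i n) x - deriv (τ n) x / τ n x - a i) • θ n x :=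
    funext fun r => (hθ r).2 i n x
  rw [hv, hφ.2 i n x]
  simp only [_root_.borderedQuotient, mulVec_add, mulVec_smul, dotProduct_add, dotProduct_smul,
    smul_eq_mul] at hup ⊢
  linear_combination hup

/-- Binary Darboux transformation of a solution of the backward system. -/
theorem BwdLin.borderedQuotient {ψ : (Fin 3 → ℤ) → ℝ → ℂ} {ωψ : (Fin 3 → ℤ) → ℝ → ι → ℂ}
    (ha : ∀ i, a i ≠ 0) (hKP : SemiKP a τ) (hτ0 : ∀ n x, τ n x ≠ 0)
    (hτd : ∀ n, Differentiable ℝ (τ n))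
    (hθ : ∀ r, FwdLin a τ fun n x => θ n x r) (hρ : ∀ s, BwdLin a τ fun n x => ρ n x s)
    (hψ : BwdLin a τ ψ)
    (hρd : ∀ n x s, DifferentiableAt ℝ (fun y => ρ n y s) x) (hψd : ∀ n, Differentiable ℝ (ψ n))
    (hΩd : ∀ i n x, a i • (Ω (fwd i n) x - Ω n x) = vecMulVec (θ n x) (ρ (fwd i n) x))
    (hΩx : ∀ n x r s, HasDerivAt (fun y => Ω n y r s) (θ n x r * ρ n x s) x)
    (hωψd : ∀ i n x, a i • (ωψ (fwd i n) x - ωψ n x) = ψ (fwd i n) x • θ n x)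
    (hωψx : ∀ n x r, HasDerivAt (fun y => ωψ n y r) (θ n x r * ψ n x) x)
    (hΩ0 : ∀ n x, (Ω n x).det ≠ 0) :
    BwdLin a (fun n x => (Ω n x).det * τ n x)
      fun n x => _root_.borderedQuotient (Ω n x)ᵀ (ωψ n x) (ρ n x) (ψ n x) := by
  refine BwdLin.of_deriv (hKP.det_mul ha hτ0 hτd hθ hρ hΩd hΩx hΩ0)
    (fun n x => mul_ne_zero (hΩ0 n x) (hτ0 n x)) fun i n x => ?_
  have hΩT : ∀ m y, (Ω m y)ᵀ.det ≠ 0 := fun m y => by simpa using hΩ0 m y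
  have hswap : ∀ m (u v : ι → ℂ),
      u ⬝ᵥ ((Ω m x)⁻¹ *ᵥ v) = v ⬝ᵥ ((Ω m x)ᵀ⁻¹ *ᵥ u) := fun m u v => by
    rw [← transpose_nonsing_inv, mulVec_transpose, dotProduct_mulVec, dotProduct_comm]
  rw [(hasDerivAt_borderedQuotient (M := fun y => (Ω n y)ᵀ) (w := θ n x)
    (fun r s => by simpa [mul_comm] using hΩx n x s r) (hΩT n)
    (fun s => by simpa [mul_comm] using hωψx n x s)
    (fun r => (hρd n x r).hasDerivAt) (hψd n x).hasDerivAt).deriv,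
    deriv_det_mul_div hτ0 hτd hΩx hΩ0, deriv_det_mul_div hτ0 hτd hΩx hΩ0, hswap, hswap]
  have hΩi : (-a i) • ((Ω (bwd i n) x)ᵀ - (Ω n x)ᵀ) = vecMulVec (ρ n x) (θ (bwd i n) x) := by
    have h := congrArg transpose (hΩd i (bwd i n) x)
    rw [fwd_bwd, transpose_vecMulVec, transpose_smul, transpose_sub] at h
    rw [← h, neg_smul, ← smul_neg, neg_sub]
  have hωi : (-a i) • (ωψ (bwd i n) x - ωψ n x) = ψ n x • θ (bwd i n) x := by
    have h := hωψd i (bwd i n) x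
    rw [fwd_bwd] at h
    rw [← h, neg_smul, ← smul_neg, neg_sub]
  have hup := borderedQuotient_update (hΩT n x) (hΩT (bwd i n) x) hΩi hωi
    (ρ (bwd i n) x) (ψ (bwd i n) x)
  have hv : (fun s => deriv (fun y => ρ n y s) x) = (-a i) • ρ (bwd i n) x +
      (deriv (τ (bwd i n)) x / τ (bwd i n) x - deriv (τ n) x / τ n x + a i) • ρ n x :=
    funext fun s => (hρ s).2 i n x
  rw [hv, hψ.2 i n x]
  simp only [_root_.borderedQuotient, mulVec_add, mulVec_smul, dotProduct_add, dotProduct_smul,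
    smul_eq_mul] at hup ⊢
  linear_combination hup

end Gram

/-- N-fold binary Darboux transformation in Grammian form: with `θ_1,…,θ_N, φ` solutions of
the forward linear system, `ρ_1,…,ρ_N, ψ` solutions of the backward linear system with
potential `τ`, Grammian potentials `ω_{rs}, ω_{φ,s}, ω_{r,ψ}`, and `det Ω` nowhere zero,
the functions `τ[N] = (det Ω)·τ`, `φ[N] = D_φ/det Ω` and `ψ[N] = D_ψ/det Ω` built from the
bordered Grammian determinants satisfy the forward, resp. backward, linear system with
potential `τ[N]`. -/
theorem binary_darboux_hirota_miwa_N_fold_grammian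
    (N : ℕ) (a : Fin 3 → ℂ) (ha : ∀ i, a i ≠ 0)
    (τ : (Fin 3 → ℤ) → ℝ → ℂ)
    (hτ0 : ∀ n x, τ n x ≠ 0)
    (hτsmooth : ∀ n, ContDiff ℝ (⊤ : ℕ∞) (τ n))
    (hKP : SemiKP a τ)
    (θ ρ : Fin N → (Fin 3 → ℤ) → ℝ → ℂ) (φ ψ : (Fin 3 → ℤ) → ℝ → ℂ)
    (hθsmooth : ∀ r n, ContDiff ℝ (⊤ : ℕ∞) (θ r n))
    (hρsmooth : ∀ r n, ContDiff ℝ (⊤ : ℕ∞) (ρ r n))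
    (hφsmooth : ∀ n, ContDiff ℝ (⊤ : ℕ∞) (φ n))
    (hψsmooth : ∀ n, ContDiff ℝ (⊤ : ℕ∞) (ψ n))
    (hθ : ∀ r, FwdLin a τ (θ r)) (hφ : FwdLin a τ φ)
    (hρ : ∀ r, BwdLin a τ (ρ r)) (hψ : BwdLin a τ ψ)
    (ω : Fin N → Fin N → (Fin 3 → ℤ) → ℝ → ℂ)
    (ωφ : Fin N → (Fin 3 → ℤ) → ℝ → ℂ)
    (ωψ : Fin N → (Fin 3 → ℤ) → ℝ → ℂ)
    (hωsmooth : ∀ r s n, ContDiff ℝ (⊤ : ℕ∞) (ω r s n))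
    (hωφsmooth : ∀ s n, ContDiff ℝ (⊤ : ℕ∞) (ωφ s n))
    (hωψsmooth : ∀ r n, ContDiff ℝ (⊤ : ℕ∞) (ωψ r n))
    (hωd : ∀ r s, ∀ i : Fin 3, ∀ n x,
      a i * (ω r s (fwd i n) x - ω r s n x) = θ r n x * ρ s (fwd i n) x)
    (hωx : ∀ r s n x, deriv (ω r s n) x = θ r n x * ρ s n x)
    (hωφd : ∀ s, ∀ i : Fin 3, ∀ n x,
      a i * (ωφ s (fwd i n) x - ωφ s n x) = φ n x * ρ s (fwd i n) x)
    (hωφx : ∀ s n x, deriv (ωφ s n) x = φ n x * ρ s n x)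
    (hωψd : ∀ r, ∀ i : Fin 3, ∀ n x,
      a i * (ωψ r (fwd i n) x - ωψ r n x) = θ r n x * ψ (fwd i n) x)
    (hωψx : ∀ r n x, deriv (ωψ r n) x = θ r n x * ψ n x)
    (hΩ0 : ∀ n x, Matrix.det (Matrix.of fun r s : Fin N => ω r s n x) ≠ 0) :
    FwdLin a
      (fun n x => Matrix.det (Matrix.of fun r s : Fin N => ω r s n x) * τ n x)
      (fun n x =>
        Matrix.det (Matrix.of fun r s : Fin (N + 1) =>
          if hr : (r : ℕ) < N then
            if hs : (s : ℕ) < N then ω ⟨r, hr⟩ ⟨s, hs⟩ n x else θ ⟨r, hr⟩ n x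
          else
            if hs : (s : ℕ) < N then ωφ ⟨s, hs⟩ n x else φ n x)
        / Matrix.det (Matrix.of fun r s : Fin N => ω r s n x))
    ∧ BwdLin a
      (fun n x => Matrix.det (Matrix.of fun r s : Fin N => ω r s n x) * τ n x)
      (fun n x =>
        Matrix.det (Matrix.of fun r s : Fin (N + 1) =>
          if hr : (r : ℕ) < N then
            if hs : (s : ℕ) < N then ω ⟨s, hs⟩ ⟨r, hr⟩ n x else ρ ⟨r, hr⟩ n x
          else
            if hs : (s : ℕ) < N then ωψ ⟨s, hs⟩ n x else ψ n x)
        / Matrix.det (Matrix.of fun r s : Fin N => ω r s n x)) := by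
  have hdiff : ∀ {f : ℝ → ℂ}, ContDiff ℝ (⊤ : ℕ∞) f → Differentiable ℝ f :=
    fun hf => hf.differentiable (by simp)
  have hτd := fun n => hdiff (hτsmooth n)
  have hΩd : ∀ i n x, a i • (Matrix.of (fun r s : Fin N => ω r s (fwd i n) x) -
      Matrix.of fun r s => ω r s n x) =
      Matrix.vecMulVec (fun r => θ r n x) fun s => ρ s (fwd i n) x := fun i n x => by
    ext r s
    simpa [Matrix.vecMulVec_apply] using hωd r s i n x
  have hΩx : ∀ n x r s, HasDerivAt (fun y => Matrix.of (fun r s : Fin N => ω r s n y) r s)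
      (θ r n x * ρ s n x) x := fun n x r s => by
    simpa [hωx] using (hdiff (hωsmooth r s n) x).hasDerivAt
  constructor
  · have hquot := fun n x => det_bordered_div_det (M := fun r s => ω r s n x) (hΩ0 n x)
      (fun s => ωφ s n x) (fun r => θ r n x) (φ n x)
    simp_rw [hquot]
    refine FwdLin.borderedQuotient (θ := fun n x r => θ r n x) (ρ := fun n x s => ρ s n x)
      (Ω := fun n x => Matrix.of fun r s => ω r s n x) (ωφ := fun n x s => ωφ s n x)
      ha hKP hτ0 hτd hθ hρ hφ (fun n x r => hdiff (hθsmooth r n) x) (fun n => hdiff (hφsmooth n))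
      hΩd hΩx (fun i n x => ?_) (fun n x s => ?_) hΩ0
    · funext s
      exact hωφd s i n x
    · simpa [hωφx] using (hdiff (hωφsmooth s n) x).hasDerivAt
  · have hT : ∀ n x, (Matrix.of fun r s : Fin N => ω r s n x).det =
        (Matrix.of fun r s : Fin N => ω s r n x).det := fun n x => by
      rw [← Matrix.det_transpose]
      rfl
    have hquot := fun n x => det_bordered_div_det (M := fun r s => ω s r n x)
      (by simpa only [hT] using hΩ0 n x) (fun s => ωψ s n x) (fun r => ρ r n x) (ψ n x)
    simp only [← hT] at hquot
    simp_rw [hquot]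
    refine BwdLin.borderedQuotient (θ := fun n x r => θ r n x) (ρ := fun n x s => ρ s n x)
      (Ω := fun n x => Matrix.of fun r s => ω r s n x) (ωψ := fun n x s => ωψ s n x)
      ha hKP hτ0 hτd hθ hρ hψ (fun n x r => hdiff (hρsmooth r n) x) (fun n => hdiff (hψsmooth n))
      hΩd hΩx (fun i n x => ?_) (fun n x s => ?_) hΩ0
    · funext s
      exact (hωψd s i n x).trans (mul_comm _ _)
    · simpa [hωψx] using (hdiff (hωψsmooth s n) x).hasDerivAt
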